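/- Let k be a field, R = k[x_1,…,x_n] the standard-graded polynomial ring, and a_1,…,a_m nonzero proper homogeneous ideals of R satisfying α(a_{t+1}) = α(a_1) + t for all 0 ≤ t ≤ m−1 (property (P2)). Fix 1 ≤ t < m with t + α(a_1) > 2, and for s ≥ 1 let b_{t,s} := ∑ over all tuples (c_1,…,c_{m−t+1}) of non-negative integers with ∑_{i=1}^{m−t+1} i·c_i = s of the product ideal a_t^{c_1} a_{t+1}^{c_2} ⋯ a_m^{c_{m−t+1}}. Then for every positive integer N, the following are equivalent: (1) for all s, r ≥ 1, α(b_{t,s})/s ≥ (α(b_{t,r}) + N − 1)/(r + N − 1) (the Demailly-type bound); (2) for all s ≥ 1, α(b_{t,s})/s ≥ (α(a_t) + N − 1)/N (the Chudnovsky-type bound); (3) N ≥ m − t + 1. -/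

import Mathlib

open MvPolynomial

attribute [local instance] MvPolynomial.gradedAlgebra

/-- The least degree of a nonzero homogeneous element of an ideal of a polynomial ring. -/
noncomputable def alphaDeg {σ K : Type*} [CommSemiring K] (I : Ideal (MvPolynomial σ K)) : ℕ :=
  sInf {d | ∃ f ∈ I, f ≠ 0 ∧ MvPolynomial.IsHomogeneous f d}

/-- `bFam a t m s` is the sum, over all tuples `(c_1, …, c_{m-t+1})` of non-negative integers
with `∑_{i=1}^{m-t+1} i * c_i = s`, of the product ideal
`a_t ^ c_1 * a_{t+1} ^ c_2 * ⋯ * a_m ^ c_{m-t+1}`. -/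
noncomputable def bFam {R : Type*} [CommRing R] (a : ℕ → Ideal R) (t m s : ℕ) : Ideal R :=
  ⨆ c : {c : Fin (m - t + 1) → ℕ // ∑ i, (i.1 + 1) * c i = s},
    ∏ i : Fin (m - t + 1), a (t + i.1) ^ c.1 i

open MvPolynomial in
theorem aux_hc {n : ℕ} {K : Type*} [Field K] {I : Ideal (MvPolynomial (Fin n) K)}
    (h : Ideal.IsHomogeneous (homogeneousSubmodule (Fin n) K) I) {f} (hf : f ∈ I) (d : ℕ) :
    homogeneousComponent d f ∈ I := by
  have := h d hf
  rwa [← decomposition.decompose'_apply]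

open MvPolynomial in
theorem aux_le {n : ℕ} {K : Type*} [Field K] {I : Ideal (MvPolynomial (Fin n) K)}
    (h : Ideal.IsHomogeneous (homogeneousSubmodule (Fin n) K) I) :
    I ≤ idealOfVars (Fin n) K ^ alphaDeg I := by
  intro f hf
  rw [mem_pow_idealOfVars_iff']
  intro x hx
  by_contra hc
  have h1 : homogeneousComponent x.degree f ≠ 0 := by
    intro h0
    apply hc
    have := coeff_homogeneousComponent x.degree f x
    rw [h0] at this
    simpa using this.symm
  have h2 : alphaDeg I ≤ x.degree :=
    Nat.sInf_le ⟨_, aux_hc h hf _, h1, homogeneousComponent_isHomogeneous _ _⟩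
  omega

open MvPolynomial in
theorem aux_ex {n : ℕ} {K : Type*} [Field K] {I : Ideal (MvPolynomial (Fin n) K)}
    (h : Ideal.IsHomogeneous (homogeneousSubmodule (Fin n) K) I) (h0 : I ≠ ⊥) :
    ∃ f ∈ I, f ≠ 0 ∧ IsHomogeneous f (alphaDeg I) := by
  obtain ⟨f, hf, hf0⟩ := Submodule.exists_mem_ne_zero_of_ne_bot h0
  obtain ⟨x, hx⟩ := exists_coeff_ne_zero hf0
  have h1 : homogeneousComponent x.degree f ≠ 0 := by
    intro h0
    apply hx
    have := coeff_homogeneousComponent x.degree f x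
    rw [h0] at this
    simpa using this.symm
  exact Nat.sInf_mem (s := {d | ∃ f ∈ I, f ≠ 0 ∧ MvPolynomial.IsHomogeneous f d})
    ⟨_, _, aux_hc h hf _, h1, homogeneousComponent_isHomogeneous _ _⟩

open MvPolynomial in
theorem aux_lower {n : ℕ} {K : Type*} [Field K] {I : Ideal (MvPolynomial (Fin n) K)} {D : ℕ}
    (h : I ≤ idealOfVars (Fin n) K ^ D) {f} (hf : f ∈ I) (h0 : f ≠ 0) {d : ℕ}
    (hd : IsHomogeneous f d) : D ≤ d := by
  obtain ⟨x, hx⟩ := exists_coeff_ne_zero h0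
  have h1 := hd hx
  have h1 : x.degree = d := by
    rw [← h1, Finsupp.degree_eq_weight_one]; rfl
  by_contra hc
  exact hx ((mem_pow_idealOfVars_iff' _ _).1 (h hf) x (by omega))

theorem aux_comb (L : ℕ) (s : ℕ) : ∃ c : Fin (L + 1) → ℕ,
    ∑ i, (i.1 + 1) * c i = s ∧ ∑ i, c i = (s + L) / (L + 1) := by
  induction s using Nat.strong_induction_on with
  | _ s ih =>
    rcases Nat.eq_zero_or_pos s with rfl | hs
    · exact ⟨0, by simp, by simp [Nat.div_eq_of_lt]⟩
    by_cases h : s ≤ L + 1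
    · refine ⟨Pi.single ⟨s - 1, by omega⟩ 1, ?_, ?_⟩
      · simp [Pi.single_apply]; omega
      · simp [Pi.single_apply]
        symm
        rw [Nat.div_eq_iff (by omega)]; omega
    · obtain ⟨c, h1, h2⟩ := ih (s - (L + 1)) (by omega)
      refine ⟨c + Pi.single (Fin.last L) 1, ?_, ?_⟩
      · simp only [Pi.add_apply, mul_add, Finset.sum_add_distrib, h1]
        simp [Pi.single_apply]; omega
      · simp only [Pi.add_apply, Finset.sum_add_distrib, h2]
        simp [Pi.single_apply]
        rw [← Nat.add_div_right _ (by omega)]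
        congr 1; omega

theorem aux_weight (L B : ℕ) (c : Fin (L + 1) → ℕ) :
    ∑ i, (B + 1 + i.1) * c i = ∑ i, (i.1 + 1) * c i + B * ∑ i, c i := by
  rw [Finset.mul_sum, ← Finset.sum_add_distrib]
  exact Finset.sum_congr rfl fun i _ => by ring

open MvPolynomial in
theorem aux_alpha {n : ℕ} {K : Type*} [Field K] (a : ℕ → Ideal (MvPolynomial (Fin n) K))
    (t m B : ℕ)
    (hne : ∀ i ≤ m - t, a (t + i) ≠ ⊥)
    (hhom : ∀ i ≤ m - t, Ideal.IsHomogeneous (homogeneousSubmodule (Fin n) K) (a (t + i)))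
    (hal : ∀ i ≤ m - t, alphaDeg (a (t + i)) = B + 1 + i) (s : ℕ) :
    alphaDeg (bFam a t m s) = s + B * ((s + (m - t)) / (m - t + 1)) := by
  apply le_antisymm
  · obtain ⟨c, h1, h2⟩ := aux_comb (m - t) s
    have hex : ∀ i : Fin (m - t + 1), ∃ f ∈ a (t + i.1), f ≠ 0 ∧ IsHomogeneous f (B + 1 + i.1) := by
      intro i
      have := aux_ex (hhom i.1 (by omega)) (hne i.1 (by omega))
      rwa [hal i.1 (by omega)] at this
    choose f hf hf0 hfd using hex
    apply Nat.sInf_le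
    refine ⟨∏ i, f i ^ c i, ?_, ?_, ?_⟩
    · have : ∏ i, f i ^ c i ∈ ∏ i : Fin (m - t + 1), a (t + i.1) ^ c i :=
        Ideal.prod_mem_prod fun i _ => Ideal.pow_mem_pow (hf i) _
      exact (le_iSup (fun c : {c : Fin (m - t + 1) → ℕ // ∑ i, (i.1 + 1) * c i = s} =>
        ∏ i : Fin (m - t + 1), a (t + i.1) ^ c.1 i) ⟨c, h1⟩) this
    · exact Finset.prod_ne_zero_iff.2 fun i _ => pow_ne_zero _ (hf0 i)
    · rw [← h2]
      nth_rw 1 [← h1]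
      rw [← aux_weight]
      exact IsHomogeneous.prod _ _ _ fun i _ => (hfd i).pow _
  · have hb : bFam a t m s ≤ idealOfVars (Fin n) K ^ (s + B * ((s + (m - t)) / (m - t + 1))) := by
      apply iSup_le
      rintro ⟨c, hc⟩
      have h1 : ∏ i : Fin (m - t + 1), a (t + i.1) ^ c i ≤
          ∏ i : Fin (m - t + 1), idealOfVars (Fin n) K ^ ((B + 1 + i.1) * c i) := by
        apply Finset.prod_le_prod' 
        intro i _
        rw [pow_mul, ← hal i.1 (by omega)]
        exact Ideal.pow_right_mono (aux_le (hhom i.1 (by omega))) _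
      refine h1.trans ?_
      rw [Finset.prod_pow_eq_pow_sum, aux_weight, hc]
      apply Ideal.pow_le_pow_right
      have : (s + (m - t)) / (m - t + 1) ≤ ∑ i, c i := by
        rw [← Nat.lt_succ_iff, Nat.div_lt_iff_lt_mul (by omega)]
        have : s ≤ (m - t + 1) * ∑ i, c i := by
          rw [← hc, Finset.mul_sum]
          exact Finset.sum_le_sum fun i _ => Nat.mul_le_mul_right _ (by omega)
        rw [Nat.succ_mul, mul_comm]; omega
      gcongr
    have hmem : alphaDeg (bFam a t m s) ∈
        {d | ∃ f ∈ bFam a t m s, f ≠ 0 ∧ MvPolynomial.IsHomogeneous f d} := by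
      apply Nat.sInf_mem
      obtain ⟨c, h1, h2⟩ := aux_comb (m - t) s
      have hex : ∀ i : Fin (m - t + 1), ∃ f ∈ a (t + i.1), f ≠ 0 ∧
          IsHomogeneous f (B + 1 + i.1) := by
        intro i
        have := aux_ex (hhom i.1 (by omega)) (hne i.1 (by omega))
        rwa [hal i.1 (by omega)] at this
      choose f hf hf0 hfd using hex
      refine ⟨_, ∏ i, f i ^ c i, ?_, ?_, IsHomogeneous.prod _ _ _ fun i _ => (hfd i).pow _⟩
      · have : ∏ i, f i ^ c i ∈ ∏ i : Fin (m - t + 1), a (t + i.1) ^ c i :=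
          Ideal.prod_mem_prod fun i _ => Ideal.pow_mem_pow (hf i) _
        exact (le_iSup (fun c : {c : Fin (m - t + 1) → ℕ // ∑ i, (i.1 + 1) * c i = s} =>
          ∏ i : Fin (m - t + 1), a (t + i.1) ^ c.1 i) ⟨c, h1⟩) this
      · exact Finset.prod_ne_zero_iff.2 fun i _ => pow_ne_zero _ (hf0 i)
    obtain ⟨f, hf, hf0, hfd⟩ := hmem
    exact aux_lower hb hf hf0 hfd

/-- Theorem 2.8: under property (P2) and `t + α(a_1) > 2`, the Demailly-type bound, the
Chudnovsky-type bound, and the numerical condition `N ≥ m - t + 1` are all equivalent. -/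
theorem chudnovsky_demailly_equiv {n : ℕ} {K : Type*} [Field K] (m : ℕ)
    (a : ℕ → Ideal (MvPolynomial (Fin n) K))
    (hne : ∀ i, 1 ≤ i → i ≤ m → a i ≠ ⊥)
    (hproper : ∀ i, 1 ≤ i → i ≤ m → a i ≠ ⊤)
    (hhom : ∀ i, 1 ≤ i → i ≤ m →
      Ideal.IsHomogeneous (homogeneousSubmodule (Fin n) K) (a i))
    (hP2 : ∀ t, t ≤ m - 1 → alphaDeg (a (t + 1)) = alphaDeg (a 1) + t)
    (t : ℕ) (ht1 : 1 ≤ t) (htm : t < m) (hbig : 2 < t + alphaDeg (a 1))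
    (N : ℕ) (hN : 0 < N) :
    ((∀ s r : ℕ, 1 ≤ s → 1 ≤ r →
        (alphaDeg (bFam a t m s) : ℝ) / s
          ≥ ((alphaDeg (bFam a t m r) : ℝ) + N - 1) / ((r : ℝ) + N - 1)) ↔
      (∀ s : ℕ, 1 ≤ s →
        (alphaDeg (bFam a t m s) : ℝ) / s
          ≥ ((alphaDeg (a t) : ℝ) + N - 1) / (N : ℝ))) ∧
    ((∀ s : ℕ, 1 ≤ s →
        (alphaDeg (bFam a t m s) : ℝ) / s
          ≥ ((alphaDeg (a t) : ℝ) + N - 1) / (N : ℝ)) ↔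
      N ≥ m - t + 1) := by
  obtain ⟨B, hB⟩ : ∃ B, alphaDeg (a 1) + t = B + 2 := ⟨alphaDeg (a 1) + t - 2, by omega⟩
  have hBpos : 0 < B := by omega
  have hal : ∀ i ≤ m - t, alphaDeg (a (t + i)) = B + 1 + i := by
    intro i hi
    have := hP2 (t + i - 1) (by omega)
    rw [show t + i - 1 + 1 = t + i by omega] at this
    omega
  have key := aux_alpha a t m B (fun i hi => hne _ (by omega) (by omega))
    (fun i hi => hhom _ (by omega) (by omega)) hal
  have hAt : alphaDeg (a t) = B + 1 := hal 0 (by omega)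
  obtain ⟨L, hL⟩ : ∃ L, m - t = L := ⟨_, rfl⟩
  rw [hL] at key ⊢
  have hN1 : (1 : ℝ) ≤ N := by exact_mod_cast hN
  have hBR : (0 : ℝ) < B := by exact_mod_cast hBpos
  have h12 : (∀ s r : ℕ, 1 ≤ s → 1 ≤ r →
        (alphaDeg (bFam a t m s) : ℝ) / s
          ≥ ((alphaDeg (bFam a t m r) : ℝ) + N - 1) / ((r : ℝ) + N - 1)) →
      (∀ s : ℕ, 1 ≤ s →
        (alphaDeg (bFam a t m s) : ℝ) / s
          ≥ ((alphaDeg (a t) : ℝ) + N - 1) / (N : ℝ)) := by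
    intro h s hs
    have h1 := h s 1 hs le_rfl
    have h2 : alphaDeg (bFam a t m 1) = alphaDeg (a t) := by
      rw [key, hAt, show (1 + L) / (L + 1) = 1 by rw [add_comm]; exact Nat.div_self (by omega)]
      ring
    rw [h2] at h1
    simpa using h1
  have h23 : (∀ s : ℕ, 1 ≤ s →
        (alphaDeg (bFam a t m s) : ℝ) / s
          ≥ ((alphaDeg (a t) : ℝ) + N - 1) / (N : ℝ)) → N ≥ L + 1 := by
    intro h
    have h1 := h (L + 1) (by omega)
    rw [key, hAt, show (L + 1 + L) / (L + 1) = 1 by rw [Nat.div_eq_iff (by omega)]; omega] at h1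
    rw [ge_iff_le, div_le_div_iff₀ (by positivity) (by positivity)] at h1
    push_cast at h1
    have h2 : (B : ℝ) * (L + 1) ≤ B * N := by nlinarith
    have h3 := le_of_mul_le_mul_left h2 hBR
    exact_mod_cast h3
  have h31 : N ≥ L + 1 → (∀ s r : ℕ, 1 ≤ s → 1 ≤ r →
        (alphaDeg (bFam a t m s) : ℝ) / s
          ≥ ((alphaDeg (bFam a t m r) : ℝ) + N - 1) / ((r : ℝ) + N - 1)) := by
    intro h s r hs hr
    have hsR : (1 : ℝ) ≤ s := by exact_mod_cast hs
    have hrR : (1 : ℝ) ≤ r := by exact_mod_cast hr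
    have hNR : (L : ℝ) + 1 ≤ N := by exact_mod_cast h
    rw [key, key]
    have e1 : s ≤ (L + 1) * ((s + L) / (L + 1)) := by
      have := Nat.lt_mul_div_succ (s + L) (show 0 < L + 1 by omega)
      rw [mul_add] at this; omega
    have e2 : (L + 1) * ((r + L) / (L + 1)) ≤ r + L := Nat.mul_div_le _ _
    generalize (s + L) / (L + 1) = p at *
    generalize (r + L) / (L + 1) = q at *
    have e1R : (s : ℝ) ≤ (L + 1) * p := by exact_mod_cast e1
    have e2R : ((L : ℝ) + 1) * q ≤ r + L := by exact_mod_cast e2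
    have hLp : (0 : ℝ) < L + 1 := by positivity
    rw [ge_iff_le, div_le_div_iff₀ (by linarith) (by linarith)]
    push_cast
    have e3 : (q : ℝ) * s ≤ p * (r + N - 1) := by
      calc (q : ℝ) * s ≤ q * ((L + 1) * p) := by gcongr
        _ = p * ((L + 1) * q) := by ring
        _ ≤ p * (r + N - 1) := by gcongr; linarith
    nlinarith [mul_le_mul_of_nonneg_left e3 hBR.le]
  exact ⟨⟨h12, fun h => h31 (h23 h)⟩, ⟨h23, fun h => h12 (h31 h)⟩⟩
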